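/- Let φ be a negation-free STL formula whose atoms are predicates π_i := (μ_i(x(t)) ≥ 0) for continuous functions μ_i : ℝⁿ → ℝ, and let x : ℝ_{≥0} → ℝⁿ be a continuous trajectory. Define the quantitative (robustness) semantics recursively by: ρ_{π_i}(x, t) := μ_i(x(t)); ρ_{φ₁∧φ₂}(x, t) := min{ρ_{φ₁}(x, t), ρ_{φ₂}(x, t)}; ρ_{φ₁∨φ₂}(x, t) := max{ρ_{φ₁}(x, t), ρ_{φ₂}(x, t)}; ρ_{□_{[a,b]}φ}(x, t) := inf_{τ ∈ [t+a, t+b]} ρ_φ(x, τ); ρ_{◇_{[a,b]}φ}(x, t) := sup_{τ ∈ [t+a, t+b]} ρ_φ(x, τ); and ρ_{φ₁ U_{[a,b]} φ₂}(x, t) := sup_{τ ∈ [t+a, t+b]} min{ ρ_{φ₂}(x, τ), inf_{τ' ∈ [t, τ]} ρ_{φ₁}(x, τ') }. Then for every negation-free formula φ and every t ≥ 0, Boolean satisfaction is equivalent to nonnegative robustness: (x, t) ⊨ φ if and only if ρ_φ(x, t) ≥ 0. -/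

import Mathlib

/-- Negation-free STL formulas over a family of atomic predicates indexed by `I`. -/
inductive STL (I : Type*) where
  | atom : I → STL I
  | and : STL I → STL I → STL I
  | or : STL I → STL I → STL I
  | always : ℝ → ℝ → STL I → STL I
  | eventually : ℝ → ℝ → STL I → STL I
  | untl : ℝ → ℝ → STL I → STL I → STL I

/-- Well-formedness: every temporal interval `[a,b]` satisfies `0 ≤ a ≤ b`. -/
def STL.WF {I : Type*} : STL I → Prop
  | .atom _ => True
  | .and φ ψ => φ.WF ∧ ψ.WF
  | .or φ ψ => φ.WF ∧ ψ.WF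
  | .always a b φ => 0 ≤ a ∧ a ≤ b ∧ φ.WF
  | .eventually a b φ => 0 ≤ a ∧ a ≤ b ∧ φ.WF
  | .untl a b φ ψ => 0 ≤ a ∧ a ≤ b ∧ φ.WF ∧ ψ.WF

/-- Boolean satisfaction of an STL formula at time `t`, given an interpretation `v`
assigning to each atom a time-varying real value (the atom holds iff the value is `≥ 0`). -/
def STL.Sat {I : Type*} (v : I → ℝ → ℝ) : STL I → ℝ → Prop
  | .atom i, t => 0 ≤ v i t
  | .and φ ψ, t => φ.Sat v t ∧ ψ.Sat v t
  | .or φ ψ, t => φ.Sat v t ∨ ψ.Sat v t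
  | .always a b φ, t => ∀ τ ∈ Set.Icc (t + a) (t + b), φ.Sat v τ
  | .eventually a b φ, t => ∃ τ ∈ Set.Icc (t + a) (t + b), φ.Sat v τ
  | .untl a b φ ψ, t =>
      ∃ τ ∈ Set.Icc (t + a) (t + b), ψ.Sat v τ ∧ ∀ τ' ∈ Set.Icc t τ, φ.Sat v τ'

/-- Quantitative (robustness) semantics of an STL formula. -/
noncomputable def STL.Rob {I : Type*} (v : I → ℝ → ℝ) : STL I → ℝ → ℝ
  | .atom i, t => v i t
  | .and φ ψ, t => min (φ.Rob v t) (ψ.Rob v t)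
  | .or φ ψ, t => max (φ.Rob v t) (ψ.Rob v t)
  | .always a b φ, t => sInf ((fun τ => φ.Rob v τ) '' Set.Icc (t + a) (t + b))
  | .eventually a b φ, t => sSup ((fun τ => φ.Rob v τ) '' Set.Icc (t + a) (t + b))
  | .untl a b φ ψ, t =>
      sSup ((fun τ => min (ψ.Rob v τ) (sInf ((fun τ' => φ.Rob v τ') '' Set.Icc t τ))) ''
        Set.Icc (t + a) (t + b))

open Set

theorem IsCompact.nonneg_sInf_image_iff {K : Set ℝ} (hK : IsCompact K) (hne : K.Nonempty)
    {f : ℝ → ℝ} (hf : ContinuousOn f K) : 0 ≤ sInf (f '' K) ↔ ∀ s ∈ K, 0 ≤ f s := by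
  rw [le_csInf_iff (hK.bddBelow_image hf) (hne.image f), forall_mem_image]

theorem IsCompact.nonneg_sSup_image_iff {K : Set ℝ} (hK : IsCompact K) (hne : K.Nonempty)
    {f : ℝ → ℝ} (hf : ContinuousOn f K) : 0 ≤ sSup (f '' K) ↔ ∃ s ∈ K, 0 ≤ f s := by
  constructor
  · intro h
    obtain ⟨s, hs, he⟩ := hK.exists_sSup_image_eq hne hf
    exact ⟨s, hs, he ▸ h⟩
  · rintro ⟨s, hs, h⟩
    exact h.trans (le_csSup (hK.bddAbove_image hf) (mem_image_of_mem f hs))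

theorem image_Icc_const_add (f : ℝ → ℝ) (a b t : ℝ) :
    f '' Icc (t + a) (t + b) = (fun s => f (t + s)) '' Icc a b := by
  rw [← image_const_add_Icc, image_image]

theorem image_Icc_add_eq_image_unitInterval (f : ℝ → ℝ) (t : ℝ) {s : ℝ} (hs : 0 ≤ s) :
    f '' Icc t (t + s) = (fun u => f (t + s * u)) '' Icc 0 1 := by
  have h : (fun u => s * u) '' Icc (0 : ℝ) 1 = Icc 0 s := by
    simpa using image_mul_left_Icc hs zero_le_one
  rw [← image_image (fun u => f (t + u)) (fun u => s * u), h, ← image_Icc_const_add, add_zero]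

theorem continuous_sInf_image_segment {f : ℝ → ℝ} (hf : Continuous f) :
    Continuous fun p : ℝ × ℝ => sInf ((fun u => f (p.1 + p.2 * u)) '' Icc 0 1) :=
  isCompact_Icc.continuous_sInf (f := fun (p : ℝ × ℝ) u => f (p.1 + p.2 * u)) (by fun_prop)

theorem untl_image_eq (f g : ℝ → ℝ) {a : ℝ} (ha : 0 ≤ a) (b t : ℝ) :
    (fun τ => min (g τ) (sInf (f '' Icc t τ))) '' Icc (t + a) (t + b) =
      (fun s => min (g (t + s)) (sInf ((fun u => f (t + s * u)) '' Icc 0 1))) '' Icc a b := by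
  rw [image_Icc_const_add]
  refine image_congr fun s hs => ?_
  rw [image_Icc_add_eq_image_unitInterval f t (ha.trans hs.1)]

theorem STL.continuous_rob {I : Type*} {v : I → ℝ → ℝ} (hv : ∀ i, Continuous (v i))
    (φ : STL I) (hφ : φ.WF) : Continuous (φ.Rob v) := by
  induction φ with
  | atom i => exact hv i
  | and φ ψ ih₁ ih₂ => exact (ih₁ hφ.1).min (ih₂ hφ.2)
  | or φ ψ ih₁ ih₂ => exact (ih₁ hφ.1).max (ih₂ hφ.2)
  | always a b φ ih =>
    have hc := ih hφ.2.2
    change Continuous fun t => sInf ((fun τ => φ.Rob v τ) '' Icc (t + a) (t + b))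
    simp only [image_Icc_const_add]
    exact isCompact_Icc.continuous_sInf (f := fun t s => φ.Rob v (t + s)) (by fun_prop)
  | eventually a b φ ih =>
    have hc := ih hφ.2.2
    change Continuous fun t => sSup ((fun τ => φ.Rob v τ) '' Icc (t + a) (t + b))
    simp only [image_Icc_const_add]
    exact isCompact_Icc.continuous_sSup (f := fun t s => φ.Rob v (t + s)) (by fun_prop)
  | untl a b φ ψ ih₁ ih₂ =>
    have h₁ := ih₁ hφ.2.2.1
    have h₂ := ih₂ hφ.2.2.2
    change Continuous fun t => sSup ((fun τ => min (ψ.Rob v τ)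
      (sInf ((φ.Rob v) '' Icc t τ))) '' Icc (t + a) (t + b))
    simp only [untl_image_eq _ _ hφ.1]
    exact isCompact_Icc.continuous_sSup
      (f := fun t s => min (ψ.Rob v (t + s)) (sInf ((fun u => φ.Rob v (t + s * u)) '' Icc 0 1)))
      ((h₂.comp (by fun_prop)).min (continuous_sInf_image_segment h₁))

theorem STL.sat_iff_rob_nonneg_of_continuous {I : Type*} {v : I → ℝ → ℝ}
    (hv : ∀ i, Continuous (v i)) (φ : STL I) (hφ : φ.WF) (t : ℝ) :
    φ.Sat v t ↔ 0 ≤ φ.Rob v t := by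
  induction φ generalizing t with
  | atom i => exact Iff.rfl
  | and φ ψ ih₁ ih₂ => simp only [Sat, Rob, le_min_iff, ih₁ hφ.1, ih₂ hφ.2]
  | or φ ψ ih₁ ih₂ => simp only [Sat, Rob, le_max_iff, ih₁ hφ.1, ih₂ hφ.2]
  | always a b φ ih =>
    obtain ⟨-, hab, hφ⟩ := hφ
    simp only [Sat, Rob, ih hφ]
    exact (isCompact_Icc.nonneg_sInf_image_iff (nonempty_Icc.2 (by linarith))
      (continuous_rob hv φ hφ).continuousOn).symm
  | eventually a b φ ih =>
    obtain ⟨-, hab, hφ⟩ := hφ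
    simp only [Sat, Rob, ih hφ]
    exact (isCompact_Icc.nonneg_sSup_image_iff (nonempty_Icc.2 (by linarith))
      (continuous_rob hv φ hφ).continuousOn).symm
  | untl a b φ ψ ih₁ ih₂ =>
    obtain ⟨ha, hab, hφ, hψ⟩ := hφ
    have h₁ := continuous_rob hv φ hφ
    have h₂ := continuous_rob hv ψ hψ
    have hc : ContinuousOn (fun τ => min (ψ.Rob v τ) (sInf ((φ.Rob v) '' Icc t τ)))
        (Icc (t + a) (t + b)) := by
      have hseg : Continuous fun τ =>
          min (ψ.Rob v τ) (sInf ((fun u => φ.Rob v (t + (τ - t) * u)) '' Icc 0 1)) :=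
        h₂.min ((continuous_sInf_image_segment h₁).comp
          (by fun_prop : Continuous fun τ : ℝ => (t, τ - t)))
      refine hseg.continuousOn.congr fun τ hτ => ?_
      have hs : 0 ≤ τ - t := by linarith [hτ.1]
      simp only [← image_Icc_add_eq_image_unitInterval _ t hs, add_sub_cancel]
    simp only [Sat, Rob, ih₁ hφ, ih₂ hψ]
    rw [isCompact_Icc.nonneg_sSup_image_iff (nonempty_Icc.2 (by linarith)) hc]
    refine exists_congr fun τ => and_congr_right fun hτ => ?_
    rw [le_min_iff, isCompact_Icc.nonneg_sInf_image_iff (nonempty_Icc.2 (by linarith [hτ.1]))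
      h₁.continuousOn]

/-- Soundness and completeness of the robustness semantics on the negation-free fragment:
for continuous predicate functions and a continuous trajectory, Boolean satisfaction is
equivalent to nonnegative robustness. -/
theorem STL.sat_iff_rob_nonneg {I : Type*} {n : ℕ}
    (μ : I → (Fin n → ℝ) → ℝ) (hμ : ∀ i, Continuous (μ i))
    (x : ℝ → (Fin n → ℝ)) (hx : Continuous x)
    (φ : STL I) (hφ : φ.WF) :
    ∀ t : ℝ, 0 ≤ t →
      (φ.Sat (fun i s => μ i (x s)) t ↔ 0 ≤ φ.Rob (fun i s => μ i (x s)) t) :=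
  fun t _ => sat_iff_rob_nonneg_of_continuous (fun i => (hμ i).comp hx) φ hφ t
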